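/- Let k ∈ ℕ and let V be a k-minimal operator system. If (I, κ) is an injective envelope of V in the category of operator systems, then the operator system I is k-minimal. -/

import Mathlib

open scoped ComplexConjugate ComplexOrder

noncomputable section

universe u v

/-- The diagonal matrix `I_n ⊗ e` in `M_n(V)`. -/
def unitMat {V : Type u} [AddCommGroup V] (n : ℕ) (e : V) : Matrix (Fin n) (Fin n) V :=
  Matrix.of fun i j => if i = j then e else 0

/-- The conjugation `α* x α ∈ M_m(V)` of `x ∈ M_n(V)` by a scalar matrix `α ∈ M_{n,m}(ℂ)`. -/
def conjAct {V : Type u} [AddCommGroup V] [Module ℂ V] {n m : ℕ}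
    (α : Matrix (Fin n) (Fin m) ℂ) (x : Matrix (Fin n) (Fin n) V) :
    Matrix (Fin m) (Fin m) V :=
  Matrix.of fun i j => ∑ p : Fin n, ∑ q : Fin n, (conj (α p i) * α q j) • x p q

section Defs

variable {V : Type u} [AddCommGroup V] [Module ℂ V] [StarAddMonoid V] [StarModule ℂ V]

/-- `(V, C, e)` is a `k`-AOU space. -/
structure IsKAOU (k : ℕ) (C : Set (Matrix (Fin k) (Fin k) V)) (e : V) : Prop where
  herm : ∀ x ∈ C, star x = x
  add_mem : ∀ x ∈ C, ∀ y ∈ C, x + y ∈ C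
  smul_mem : ∀ r : ℝ, 0 ≤ r → ∀ x ∈ C, (r : ℂ) • x ∈ C
  proper : ∀ x ∈ C, -x ∈ C → x = 0
  compat : ∀ α : Matrix (Fin k) (Fin k) ℂ, ∀ x ∈ C, conjAct α x ∈ C
  orderUnit : ∀ x : Matrix (Fin k) (Fin k) V, star x = x →
    ∃ r : ℝ, 0 < r ∧ (r : ℂ) • unitMat k e - x ∈ C
  arch : ∀ x : Matrix (Fin k) (Fin k) V,
    (∀ r : ℝ, 0 < r → x + (r : ℂ) • unitMat k e ∈ C) → x ∈ C

/-- A matrix ordering on the `*`-vector space `V`. -/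
structure IsMatrixOrdering (C : ∀ n : ℕ, Set (Matrix (Fin n) (Fin n) V)) : Prop where
  herm : ∀ n, ∀ x ∈ C n, star x = x
  add_mem : ∀ n, ∀ x ∈ C n, ∀ y ∈ C n, x + y ∈ C n
  smul_mem : ∀ n, ∀ r : ℝ, 0 ≤ r → ∀ x ∈ C n, (r : ℂ) • x ∈ C n
  proper : ∀ n, ∀ x ∈ C n, -x ∈ C n → x = 0
  compat : ∀ n m : ℕ, ∀ α : Matrix (Fin n) (Fin m) ℂ, ∀ x ∈ C n, conjAct α x ∈ C m

/-- `(V, {C_n}, e)` is an (abstract) operator system. -/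
structure IsOperatorSystem (C : ∀ n : ℕ, Set (Matrix (Fin n) (Fin n) V)) (e : V)
    extends IsMatrixOrdering C : Prop where
  orderUnit : ∀ n : ℕ, ∀ x : Matrix (Fin n) (Fin n) V, star x = x →
    ∃ r : ℝ, 0 < r ∧ (r : ℂ) • unitMat n e - x ∈ C n
  arch : ∀ n : ℕ, ∀ x : Matrix (Fin n) (Fin n) V,
    (∀ r : ℝ, 0 < r → x + (r : ℂ) • unitMat n e ∈ C n) → x ∈ C n

/-- The cones `C_n^{k-min}` associated to a `k`-AOU space `(V, C, e)`. -/
def kMinCone (k : ℕ) (C : Set (Matrix (Fin k) (Fin k) V)) (n : ℕ) :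
    Set (Matrix (Fin n) (Fin n) V) :=
  {x | star x = x ∧ ∀ α : Matrix (Fin n) (Fin k) ℂ, conjAct α x ∈ C}

/-- `{𝒞_n}` is an extension of the `k`-AOU space `(V, C, e)`: a matrix ordering with
`𝒞_k = C` making `(V, {𝒞_n}, e)` an operator system. -/
def IsExtension (k : ℕ) (C : Set (Matrix (Fin k) (Fin k) V)) (e : V)
    (𝒞 : ∀ n : ℕ, Set (Matrix (Fin n) (Fin n) V)) : Prop :=
  IsOperatorSystem 𝒞 e ∧ 𝒞 k = C

end Defs

/-- Bundled data of a `k`-AOU space: a `*`-vector space with a distinguished subset of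
`M_k(carrier)` and a distinguished element. -/
structure KAOUData (k : ℕ) : Type (u + 1) where
  carrier : Type u
  [addCommGroup : AddCommGroup carrier]
  [module : Module ℂ carrier]
  [starAddMonoid : StarAddMonoid carrier]
  [starModule : StarModule ℂ carrier]
  cone : Set (Matrix (Fin k) (Fin k) carrier)
  unit : carrier

attribute [instance] KAOUData.addCommGroup KAOUData.module KAOUData.starAddMonoid
  KAOUData.starModule

/-- The bundled data is a `k`-AOU space. -/
def KAOUData.IsK {k : ℕ} (A : KAOUData.{u} k) : Prop := IsKAOU k A.cone A.unit

/-- `φ` is a unital `k`-positive map between (the data of) `k`-AOU spaces. -/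
def UKPos {k : ℕ} (A : KAOUData.{u} k) (B : KAOUData.{v} k)
    (φ : A.carrier →ₗ[ℂ] B.carrier) : Prop :=
  φ A.unit = B.unit ∧ ∀ x ∈ A.cone, x.map ⇑φ ∈ B.cone

/-- `φ` is a unital `k`-order embedding between (the data of) `k`-AOU spaces. -/
def UKOrderEmb {k : ℕ} (A : KAOUData.{u} k) (B : KAOUData.{v} k)
    (φ : A.carrier →ₗ[ℂ] B.carrier) : Prop :=
  UKPos A B φ ∧ Function.Injective φ ∧
    ∀ x : Matrix (Fin k) (Fin k) A.carrier, x.map ⇑φ ∈ B.cone → x ∈ A.cone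

/-- Bundled data of an operator system: a `*`-vector space with a family of distinguished
matricial subsets and a distinguished element. -/
structure OSData : Type (u + 1) where
  carrier : Type u
  [addCommGroup : AddCommGroup carrier]
  [module : Module ℂ carrier]
  [starAddMonoid : StarAddMonoid carrier]
  [starModule : StarModule ℂ carrier]
  cones : ∀ n : ℕ, Set (Matrix (Fin n) (Fin n) carrier)
  unit : carrier

attribute [instance] OSData.addCommGroup OSData.module OSData.starAddMonoid OSData.starModule

/-- The bundled data is an operator system. -/
def OSData.IsOS (A : OSData.{u}) : Prop := IsOperatorSystem A.cones A.unit

/-- `φ` is a unital completely positive map between (the data of) operator systems. -/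
def UCP (A : OSData.{u}) (B : OSData.{v}) (φ : A.carrier →ₗ[ℂ] B.carrier) : Prop :=
  φ A.unit = B.unit ∧ ∀ n : ℕ, ∀ x ∈ A.cones n, x.map ⇑φ ∈ B.cones n

/-- `φ` is a unital complete order embedding between (the data of) operator systems. -/
def UCOrderEmb (A : OSData.{u}) (B : OSData.{v}) (φ : A.carrier →ₗ[ℂ] B.carrier) : Prop :=
  UCP A B φ ∧ Function.Injective φ ∧
    ∀ (n : ℕ) (x : Matrix (Fin n) (Fin n) A.carrier), x.map ⇑φ ∈ B.cones n → x ∈ A.cones n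

/-- `A` is `k`-minimal as an operator system. -/
def OSData.kMinimal (A : OSData.{u}) (k : ℕ) : Prop :=
  ∀ n : ℕ, A.cones n = kMinCone k (A.cones k) n

/-- `T` is an injective operator system. -/
def OSInjective (T : OSData.{u}) : Prop :=
  ∀ A B : OSData.{u}, A.IsOS → B.IsOS →
    ∀ ι : A.carrier →ₗ[ℂ] B.carrier, UCOrderEmb A B ι →
      ∀ φ : A.carrier →ₗ[ℂ] T.carrier, UCP A T φ →
        ∃ ψ : B.carrier →ₗ[ℂ] T.carrier, UCP B T ψ ∧ ψ.comp ι = φ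

/-- `(T, κ)` is an essential extension of the operator system `Vd`: every unital completely
positive map out of `T` restricting to a unital complete order embedding on (the image of)
`Vd` is itself a unital complete order embedding. -/
def OSEssential (Vd T : OSData.{u}) (κ : Vd.carrier →ₗ[ℂ] T.carrier) : Prop :=
  ∀ W : OSData.{u}, W.IsOS →
    ∀ φ : T.carrier →ₗ[ℂ] W.carrier, UCP T W φ →
      UCOrderEmb Vd W (φ.comp κ) → UCOrderEmb T W φ

/-- `(T, κ)` is an injective envelope of the operator system `Vd`. -/
def IsInjEnvelopeOS (Vd T : OSData.{u}) (κ : Vd.carrier →ₗ[ℂ] T.carrier) : Prop :=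
  T.IsOS ∧ OSInjective T ∧ UCOrderEmb Vd T κ ∧ OSEssential Vd T κ

/-- `T` is an injective `k`-AOU space. -/
def KInjective {k : ℕ} (T : KAOUData.{u} k) : Prop :=
  ∀ A B : KAOUData.{u} k, A.IsK → B.IsK →
    ∀ ι : A.carrier →ₗ[ℂ] B.carrier, UKOrderEmb A B ι →
      ∀ φ : A.carrier →ₗ[ℂ] T.carrier, UKPos A T φ →
        ∃ ψ : B.carrier →ₗ[ℂ] T.carrier, UKPos B T ψ ∧ ψ.comp ι = φ

/-- `(T, κ)` is an essential extension of the `k`-AOU space `Vd`. -/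
def KEssential {k : ℕ} (Vd T : KAOUData.{u} k) (κ : Vd.carrier →ₗ[ℂ] T.carrier) : Prop :=
  ∀ W : KAOUData.{u} k, W.IsK →
    ∀ φ : T.carrier →ₗ[ℂ] W.carrier, UKPos T W φ →
      UKOrderEmb Vd W (φ.comp κ) → UKOrderEmb T W φ

/-- `(T, κ)` is an injective envelope of the `k`-AOU space `Vd`. -/
def IsInjEnvelopeK {k : ℕ} (Vd T : KAOUData.{u} k) (κ : Vd.carrier →ₗ[ℂ] T.carrier) : Prop :=
  T.IsK ∧ KInjective T ∧ UKOrderEmb Vd T κ ∧ KEssential Vd T κ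

/-- The operator system `V_{k-min}` (as data) associated to a `k`-AOU space. -/
def KAOUData.kminOS {k : ℕ} (A : KAOUData.{u} k) : OSData.{u} where
  carrier := A.carrier
  cones := kMinCone k A.cone
  unit := A.unit

/-- The `k`-AOU space (as data) obtained from an operator system by keeping the level-`k`
cone. -/
def OSData.levelK (T : OSData.{u}) (k : ℕ) : KAOUData.{u} k where
  carrier := T.carrier
  cone := T.cones k
  unit := T.unit

section ConjAct

variable {V : Type u} [AddCommGroup V] [Module ℂ V]

theorem conjAct_apply {n m : ℕ} (α : Matrix (Fin n) (Fin m) ℂ) (x : Matrix (Fin n) (Fin n) V)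
    (i j : Fin m) :
    conjAct α x i j = ∑ p : Fin n, ∑ q : Fin n, (conj (α p i) * α q j) • x p q := rfl

theorem conjAct_add {n m : ℕ} (α : Matrix (Fin n) (Fin m) ℂ) (x y : Matrix (Fin n) (Fin n) V) :
    conjAct α (x + y) = conjAct α x + conjAct α y := by
  ext i j
  simp [conjAct_apply, Finset.sum_add_distrib]

theorem conjAct_smul {n m : ℕ} (α : Matrix (Fin n) (Fin m) ℂ) (c : ℂ)
    (x : Matrix (Fin n) (Fin n) V) :
    conjAct α (c • x) = c • conjAct α x := by
  ext i j
  simp [conjAct_apply, Finset.smul_sum, smul_comm c]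

theorem conjAct_neg {n m : ℕ} (α : Matrix (Fin n) (Fin m) ℂ) (x : Matrix (Fin n) (Fin n) V) :
    conjAct α (-x) = -conjAct α x := by
  ext i j
  simp [conjAct_apply]

theorem conjAct_sub {n m : ℕ} (α : Matrix (Fin n) (Fin m) ℂ) (x y : Matrix (Fin n) (Fin n) V) :
    conjAct α (x - y) = conjAct α x - conjAct α y := by
  rw [sub_eq_add_neg, conjAct_add, conjAct_neg, ← sub_eq_add_neg]

theorem conjAct_conjAct {n m l : ℕ} (α : Matrix (Fin n) (Fin m) ℂ) (β : Matrix (Fin m) (Fin l) ℂ)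
    (x : Matrix (Fin n) (Fin n) V) :
    conjAct β (conjAct α x) = conjAct (α * β) x := by
  ext i j
  simp only [conjAct_apply, Matrix.mul_apply, map_sum, map_mul, Finset.sum_mul_sum,
    Finset.sum_smul, Finset.smul_sum, smul_smul]
  calc _ = ∑ r : Fin m, ∑ p : Fin n, ∑ s : Fin m, ∑ q : Fin n,
        (conj (β r i) * β s j * (conj (α p r) * α q s)) • x p q :=
        Finset.sum_congr rfl fun _ _ => Finset.sum_comm
    _ = ∑ p : Fin n, ∑ r : Fin m, ∑ s : Fin m, ∑ q : Fin n,
        (conj (β r i) * β s j * (conj (α p r) * α q s)) • x p q := Finset.sum_comm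
    _ = ∑ p : Fin n, ∑ r : Fin m, ∑ q : Fin n, ∑ s : Fin m,
        (conj (β r i) * β s j * (conj (α p r) * α q s)) • x p q :=
        Finset.sum_congr rfl fun _ _ => Finset.sum_congr rfl fun _ _ => Finset.sum_comm
    _ = ∑ p : Fin n, ∑ q : Fin n, ∑ r : Fin m, ∑ s : Fin m,
        (conj (β r i) * β s j * (conj (α p r) * α q s)) • x p q :=
        Finset.sum_congr rfl fun _ _ => Finset.sum_comm
    _ = _ := by
        refine Finset.sum_congr rfl fun p _ => Finset.sum_congr rfl fun q _ =>
          Finset.sum_congr rfl fun r _ => Finset.sum_congr rfl fun s _ => ?_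
        congr 1
        ring

theorem conjAct_map {W : Type v} [AddCommGroup W] [Module ℂ W] {n m : ℕ}
    (α : Matrix (Fin n) (Fin m) ℂ) (φ : V →ₗ[ℂ] W) (x : Matrix (Fin n) (Fin n) V) :
    conjAct α (x.map φ) = (conjAct α x).map φ := by
  ext i j
  simp [conjAct_apply]

theorem conjAct_star [StarAddMonoid V] [StarModule ℂ V] {n m : ℕ}
    (α : Matrix (Fin n) (Fin m) ℂ) (x : Matrix (Fin n) (Fin n) V) :
    conjAct α (star x) = star (conjAct α x) := by
  ext i j
  simp only [conjAct_apply, Matrix.star_apply, star_sum, star_smul]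
  rw [Finset.sum_comm]
  simp [mul_comm]

/-- Polarization: a matrix is determined by its conjugates by column vectors. -/
theorem eq_zero_of_forall_conjAct_eq_zero {k n : ℕ} (hk : 0 < k) {x : Matrix (Fin n) (Fin n) V}
    (h : ∀ α : Matrix (Fin n) (Fin k) ℂ, conjAct α x = 0) : x = 0 := by
  have key (a : Fin n → ℂ) : ∑ p, ∑ q, (conj (a p) * a q) • x p q = 0 :=
    congrFun (congrFun (h (Matrix.of fun p _ => a p)) ⟨0, hk⟩) ⟨0, hk⟩
  have diag (p : Fin n) : x p p = 0 := by
    simpa [Pi.single_apply, ite_smul, apply_ite conj, Finset.sum_ite_eq] using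
      key (Pi.single p 1)
  ext p q
  have pol (c : ℂ) : c • x p q + conj c • x q p = 0 := by
    simpa [add_mul, mul_add, add_smul, Finset.sum_add_distrib, ite_smul, apply_ite conj, diag,
      add_comm] using key fun i => (if i = p then 1 else 0) + (if i = q then c else 0)
  have hadd : x p q + x q p = 0 := by simpa using pol 1
  have hsub : x p q = x q p := by
    have := pol Complex.I
    rw [Complex.conj_I, neg_smul, ← sub_eq_add_neg, sub_eq_zero] at this
    exact smul_right_injective V Complex.I_ne_zero this
  rw [← hsub, ← two_smul ℂ] at hadd
  simpa using hadd

end ConjAct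

section KMin

variable {V : Type u} [AddCommGroup V] [Module ℂ V] [StarAddMonoid V]
  {C : ∀ n : ℕ, Set (Matrix (Fin n) (Fin n) V)} {e : V}

theorem IsMatrixOrdering.subset_kMinCone (h : IsMatrixOrdering C) (k n : ℕ) :
    C n ⊆ kMinCone k (C k) n :=
  fun x hx => ⟨h.herm n x hx, fun α => h.compat n k α x hx⟩

variable [StarModule ℂ V]

theorem IsOperatorSystem.star_unitMat (h : IsOperatorSystem C e) (n : ℕ) :
    star (unitMat n e) = unitMat n e := by
  obtain ⟨r, hr, hmem⟩ := h.orderUnit n 0 (star_zero _)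
  have := h.herm n _ hmem
  rw [sub_zero, star_smul, Complex.star_def, Complex.conj_ofReal] at this
  exact smul_right_injective _ (Complex.ofReal_ne_zero.mpr hr.ne') this

/-- The `k`-minimal cones of an operator system again form an operator system. -/
theorem IsOperatorSystem.kMinCone (h : IsOperatorSystem C e) {k : ℕ} (hk : 0 < k) :
    IsOperatorSystem (kMinCone k (C k)) e where
  herm _ _ hx := hx.1
  add_mem n x hx y hy := ⟨by rw [star_add, hx.1, hy.1], fun α => by
    rw [conjAct_add]
    exact h.add_mem k _ (hx.2 α) _ (hy.2 α)⟩
  smul_mem n r hr x hx := ⟨by rw [star_smul, hx.1, Complex.star_def, Complex.conj_ofReal],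
    fun α => by
      rw [conjAct_smul]
      exact h.smul_mem k r hr _ (hx.2 α)⟩
  proper n x hx hx' := eq_zero_of_forall_conjAct_eq_zero hk fun α =>
    h.proper k _ (hx.2 α) (conjAct_neg α x ▸ hx'.2 α)
  compat n m α x hx := ⟨by rw [← conjAct_star, hx.1], fun β => by
    rw [conjAct_conjAct]
    exact hx.2 _⟩
  orderUnit n x hx := by
    obtain ⟨r, hr, hmem⟩ := h.orderUnit n x hx
    exact ⟨r, hr, h.subset_kMinCone k n hmem⟩
  arch n x hx := by
    refine ⟨?_, fun α => ?_⟩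
    · have := (hx 1 one_pos).1
      rw [Complex.ofReal_one, one_smul, star_add, h.star_unitMat] at this
      exact add_right_cancel this
    · obtain ⟨s, hs, hmem⟩ := h.orderUnit k (conjAct α (unitMat n e))
        (by rw [← conjAct_star, h.star_unitMat])
      refine h.arch k _ fun r hr => ?_
      have hrs : 0 < r / s := div_pos hr hs
      have := h.add_mem k _ ((hx _ hrs).2 α) _ (h.smul_mem k _ hrs.le _ hmem)
      rw [conjAct_add, conjAct_smul, smul_sub, smul_smul, ← Complex.ofReal_mul,
        div_mul_cancel₀ _ hs.ne', add_assoc, add_sub_cancel] at this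
      exact this

end KMin

/-- If `V` is a `k`-minimal operator system and `(I, κ)` is an injective
envelope of `V` in the category of operator systems, then `I` is `k`-minimal. -/
theorem stmt_12 (k : ℕ) (hk : 0 < k) (Vd T : OSData.{u}) (hV : Vd.IsOS)
    (hVmin : Vd.kMinimal k) (κ : Vd.carrier →ₗ[ℂ] T.carrier)
    (henv : IsInjEnvelopeOS Vd T κ) :
    T.kMinimal k := by
  obtain ⟨hT, -, ⟨hκ, hinj, hemb⟩, hess⟩ := henv
  have hsub := hT.subset_kMinCone k
  obtain ⟨-, -, hid⟩ := hess (T.levelK k).kminOS (hT.kMinCone hk) LinearMap.id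
    ⟨rfl, fun n x hx => hsub n hx⟩
    ⟨⟨hκ.1, fun n x hx => hsub n (hκ.2 n x hx)⟩, hinj, fun n x hx => by
      have hx' : ∀ α : Matrix (Fin n) (Fin k) ℂ, conjAct α x ∈ Vd.cones k := fun α =>
        hemb k _ (conjAct_map α κ x ▸ hx.2 α)
      rw [hVmin n]
      refine ⟨sub_eq_zero.mp (eq_zero_of_forall_conjAct_eq_zero hk fun α => ?_), hx'⟩
      rw [conjAct_sub, conjAct_star, hV.herm k _ (hx' α), sub_self]⟩
  exact fun n => (hsub n).antisymm fun x hx => hid n x hx
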